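/- Swapping preserves permutation equivalence: if Φ·Ψ is a loath pair of consecutive multisteps witnessed by a step Χ (i.e., Χ has the same source as Φ, Φ ⊆ Χ, and the step ψ := Χ/Φ satisfies ψ ⊆ Ψ), then Φ·Ψ is permutation equivalent to the result Χ·(Ψ/ψ) of swapping Χ for Φ·Ψ. -/

import Mathlib

universe u

/-- A string rewrite system over alphabet `α`: a type of rules with nonempty
left- and right-hand side strings. -/
structure SRS (α : Type u) where
  Rule : Type u
  lhs : Rule → List α
  rhs : Rule → List α
  lhs_ne : ∀ ρ, lhs ρ ≠ []
  rhs_ne : ∀ ρ, rhs ρ ≠ []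

namespace SRS

variable {α : Type u}

/-- Proof terms over a string rewrite system, indexed by source and target strings. -/
inductive PT (S : SRS α) : List α → List α → Type u
  | eps : PT S [] []
  | letter (a : α) : PT S [a] [a]
  | rule (ρ : S.Rule) : PT S (S.lhs ρ) (S.rhs ρ)
  | hcomp {s₁ t₁ s₂ t₂ : List α} : PT S s₁ t₁ → PT S s₂ t₂ → PT S (s₁ ++ s₂) (t₁ ++ t₂)
  | vcomp {s t u : List α} : PT S s t → PT S t u → PT S s u

namespace PT

variable {S : SRS α}

/-- A string viewed as a proof term. -/
def ofString (S : SRS α) : (s : List α) → PT S s s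
  | [] => .eps
  | a :: s => .hcomp (.letter a) (ofString S s)

/-- The source string of a proof term. -/
def src {s t : List α} (_ : PT S s t) : List α := s

/-- The target string of a proof term. -/
def tgt {s t : List α} (_ : PT S s t) : List α := t

/-- Number of occurrences of rule symbols in a proof term. -/
def ruleCount : {s t : List α} → PT S s t → ℕ
  | _, _, .eps => 0
  | _, _, .letter _ => 0
  | _, _, .rule _ => 1
  | _, _, .hcomp γ δ => ruleCount γ + ruleCount δ
  | _, _, .vcomp γ δ => ruleCount γ + ruleCount δ

/-- A proof term contains no vertical composition (is a multistep). -/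
def noVcomp : {s t : List α} → PT S s t → Prop
  | _, _, .eps => True
  | _, _, .letter _ => True
  | _, _, .rule _ => True
  | _, _, .hcomp γ δ => noVcomp γ ∧ noVcomp δ
  | _, _, .vcomp _ _ => False

/-- An empty multistep: no vertical composition and no rule symbols. -/
def IsEmptyMS {s t : List α} (γ : PT S s t) : Prop := γ.noVcomp ∧ γ.ruleCount = 0

/-- A (single) step: a multistep with exactly one occurrence of a rule symbol. -/
def IsStep {s t : List α} (γ : PT S s t) : Prop := γ.noVcomp ∧ γ.ruleCount = 1

/-- Permutation equivalence: the least congruence containing the horizontal and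
vertical monoid laws and the exchange law. -/
inductive PermEq : ∀ {s t s' t' : List α}, PT S s t → PT S s' t' → Prop
  | refl {s t} (γ : PT S s t) : PermEq γ γ
  | symm {s t s' t'} {γ : PT S s t} {δ : PT S s' t'} : PermEq γ δ → PermEq δ γ
  | trans {s t s' t' s'' t''} {γ : PT S s t} {δ : PT S s' t'} {ζ : PT S s'' t''} :
      PermEq γ δ → PermEq δ ζ → PermEq γ ζ
  | hcongr {s₁ t₁ s₂ t₂ s₁' t₁' s₂' t₂'} {γ : PT S s₁ t₁} {γ' : PT S s₁' t₁'}
      {δ : PT S s₂ t₂} {δ' : PT S s₂' t₂'} :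
      PermEq γ γ' → PermEq δ δ' → PermEq (γ.hcomp δ) (γ'.hcomp δ')
  | vcongr {s t u s' t' u'} {γ : PT S s t} {δ : PT S t u} {γ' : PT S s' t'} {δ' : PT S t' u'} :
      PermEq γ γ' → PermEq δ δ' → PermEq (γ.vcomp δ) (γ'.vcomp δ')
  | hUnitL {s t} (γ : PT S s t) : PermEq (PT.hcomp .eps γ) γ
  | hUnitR {s t} (γ : PT S s t) : PermEq (PT.hcomp γ .eps) γ
  | hAssoc {s₁ t₁ s₂ t₂ s₃ t₃} (γ : PT S s₁ t₁) (δ : PT S s₂ t₂) (ζ : PT S s₃ t₃) :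
      PermEq ((γ.hcomp δ).hcomp ζ) (γ.hcomp (δ.hcomp ζ))
  | vUnitL {s s' t} {σ : PT S s s'} {γ : PT S s' t} :
      IsEmptyMS σ → PermEq (σ.vcomp γ) γ
  | vUnitR {s t t'} {γ : PT S s t} {τ : PT S t t'} :
      IsEmptyMS τ → PermEq (γ.vcomp τ) γ
  | vAssoc {s t u v} (γ : PT S s t) (δ : PT S t u) (ζ : PT S u v) :
      PermEq ((γ.vcomp δ).vcomp ζ) (γ.vcomp (δ.vcomp ζ))
  | exchange {s₁ t₁ u₁ s₂ t₂ u₂} (γ : PT S s₁ t₁) (ζ : PT S t₁ u₁)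
      (δ : PT S s₂ t₂) (η : PT S t₂ u₂) :
      PermEq ((γ.hcomp δ).vcomp (ζ.hcomp η)) ((γ.vcomp ζ).hcomp (δ.vcomp η))

/-- `Resid Φ Ψ Θ` : the multistep `Φ` is contained in the multistep `Ψ`
(obtained from `Ψ` by replacing the non-selected occurrences of rule symbols by
their source strings), with residual `Θ = Ψ/Φ` (obtained from `Ψ` by replacing
the selected occurrences of rule symbols by their target strings). -/
inductive Resid : ∀ {s t u : List α}, PT S s t → PT S s u → PT S t u → Prop
  | eps : Resid .eps .eps .eps
  | letter (a : α) : Resid (.letter a) (.letter a) (.letter a)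
  | ruleKept (ρ : S.Rule) : Resid (.rule ρ) (.rule ρ) (ofString S (S.rhs ρ))
  | ruleSkipped (ρ : S.Rule) : Resid (ofString S (S.lhs ρ)) (.rule ρ) (.rule ρ)
  | hcomp {s₁ t₁ u₁ s₂ t₂ u₂} {Φ₁ : PT S s₁ t₁} {Ψ₁ : PT S s₁ u₁} {Θ₁ : PT S t₁ u₁}
      {Φ₂ : PT S s₂ t₂} {Ψ₂ : PT S s₂ u₂} {Θ₂ : PT S t₂ u₂} :
      Resid Φ₁ Ψ₁ Θ₁ → Resid Φ₂ Ψ₂ Θ₂ → Resid (Φ₁.hcomp Φ₂) (Ψ₁.hcomp Ψ₂) (Θ₁.hcomp Θ₂)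

/-- Containment `Φ ⊆ Ψ` of multisteps with the same source. -/
def Contained {s t u : List α} (Φ : PT S s t) (Ψ : PT S s u) : Prop := ∃ Θ, Resid Φ Ψ Θ

/-- A pair of consecutive multisteps `Φ·Ψ` is loath if there is a multistep `X`
co-initial with `Φ` such that `Φ ⊆ X` and the residual `ψ := X/Φ` is a single
step with `ψ ⊆ Ψ`. -/
def Loath {s t u : List α} (Φ : PT S s t) (Ψ : PT S t u) : Prop :=
  ∃ (v : List α) (X : PT S s v) (ψ : PT S t v),
    X.noVcomp ∧ Resid Φ X ψ ∧ IsStep ψ ∧ ∃ Θ : PT S v u, Resid ψ Ψ Θ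

/-- Right-associated vertical composition of single steps. -/
inductive IsStepSeq : ∀ {s t : List α}, PT S s t → Prop
  | single {s t} {φ : PT S s t} : IsStep φ → IsStepSeq φ
  | cons {s t u} {φ : PT S s t} {γ : PT S t u} : IsStep φ → IsStepSeq γ → IsStepSeq (φ.vcomp γ)

/-- A reduction: an empty multistep or a right-associated composition of steps. -/
def IsRed {s t : List α} (γ : PT S s t) : Prop := IsEmptyMS γ ∨ IsStepSeq γ

/-- Right-associated vertical composition of nonempty multisteps. -/
inductive IsMSSeq : ∀ {s t : List α}, PT S s t → Prop
  | single {s t} {Φ : PT S s t} : Φ.noVcomp → Φ.ruleCount ≠ 0 → IsMSSeq Φ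
  | cons {s t u} {Φ : PT S s t} {γ : PT S t u} :
      Φ.noVcomp → Φ.ruleCount ≠ 0 → IsMSSeq γ → IsMSSeq (Φ.vcomp γ)

/-- A multistep reduction: an empty multistep or a right-associated vertical
composition of nonempty multisteps. -/
def IsMSRed {s t : List α} (γ : PT S s t) : Prop := IsEmptyMS γ ∨ IsMSSeq γ

/-- `FirstMS γ Φ` : `Φ` is the first multistep of the multistep reduction `γ`. -/
inductive FirstMS : ∀ {s t v : List α}, PT S s t → PT S s v → Prop
  | base {s t} {Φ : PT S s t} : Φ.noVcomp → FirstMS Φ Φ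
  | cons {s t u} {Φ : PT S s t} {γ : PT S t u} : Φ.noVcomp → FirstMS (Φ.vcomp γ) Φ

/-- No pair of consecutive multisteps is loath. -/
inductive NoLoathPairs : ∀ {s t : List α}, PT S s t → Prop
  | base {s t} {γ : PT S s t} : γ.noVcomp → NoLoathPairs γ
  | cons {s t u} {Φ : PT S s t} {γ : PT S t u} : Φ.noVcomp → NoLoathPairs γ →
      (∀ {v : List α} (Ψ : PT S t v), FirstMS γ Ψ → ¬ Loath Φ Ψ) → NoLoathPairs (Φ.vcomp γ)

/-- A greedy multistep reduction. -/
def IsGreedyMSR {s t : List α} (γ : PT S s t) : Prop := IsMSRed γ ∧ NoLoathPairs γ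

/-- Swapping a loath pair of consecutive multisteps, anywhere within a
(right-associated) multistep reduction: a loath pair `Φ·Ψ` with witness `X`
(where `ψ := X/Φ` is a step with `ψ ⊆ Ψ`) is replaced by `X·(Ψ/ψ)`. -/
inductive Swap : ∀ {s t : List α}, PT S s t → PT S s t → Prop
  | head {s t u v} {Φ : PT S s t} {Ψ : PT S t u} {X : PT S s v} {ψ : PT S t v} {Θ : PT S v u} :
      X.noVcomp → Resid Φ X ψ → IsStep ψ → Resid ψ Ψ Θ → Swap (Φ.vcomp Ψ) (X.vcomp Θ)
  | headCons {s t u w v} {Φ : PT S s t} {Ψ : PT S t u} {γ : PT S u w} {X : PT S s v}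
      {ψ : PT S t v} {Θ : PT S v u} :
      X.noVcomp → Resid Φ X ψ → IsStep ψ → Resid ψ Ψ Θ →
      Swap (Φ.vcomp (Ψ.vcomp γ)) (X.vcomp (Θ.vcomp γ))
  | tail {s t u} {Φ : PT S s t} {γ γ' : PT S t u} :
      Φ.noVcomp → Swap γ γ' → Swap (Φ.vcomp γ) (Φ.vcomp γ')

/-- Removal of a trailing empty multistep. -/
inductive Drop : ∀ {s t : List α}, PT S s t → PT S s t → Prop
  | drop {s t} {Φ : PT S s t} {e : PT S t t} : IsEmptyMS e → Drop (Φ.vcomp e) Φ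
  | tail {s t u} {Φ : PT S s t} {γ γ' : PT S t u} : Drop γ γ' → Drop (Φ.vcomp γ) (Φ.vcomp γ')

/-- Swapping together with removal of trailing empty multisteps. -/
def SwapD {s t : List α} (γ δ : PT S s t) : Prop := Swap γ δ ∨ Drop γ δ

/-- The list of numbers of rule symbols of the constituent multisteps of a
(right-associated) multistep reduction, head first.  Its reverse, compared
lexicographically, is the Sekar–Ramakrishnan measure. -/
def msList : {s t : List α} → PT S s t → List ℕ
  | _, _, .vcomp Φ γ => ruleCount Φ :: msList γ
  | _, _, γ => [ruleCount γ]

/-- The rule occurrences of a multistep, with the starting position of the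
interval of letter positions each occupies in the source string. -/
def srcOccs : {s t : List α} → PT S s t → List (ℕ × S.Rule)
  | _, _, .eps => []
  | _, _, .letter _ => []
  | _, _, .rule ρ => [(0, ρ)]
  | _, _, @PT.hcomp _ _ s₁ _ _ _ γ δ =>
      srcOccs γ ++ (srcOccs δ).map (fun p => (s₁.length + p.1, p.2))
  | _, _, .vcomp _ _ => []

/-- The rule occurrences of a multistep, with the starting position of the
interval of letter positions each occupies in the target string. -/
def tgtOccs : {s t : List α} → PT S s t → List (ℕ × S.Rule)
  | _, _, .eps => []
  | _, _, .letter _ => []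
  | _, _, .rule ρ => [(0, ρ)]
  | _, _, @PT.hcomp _ _ _ t₁ _ _ γ δ =>
      tgtOccs γ ++ (tgtOccs δ).map (fun p => (t₁.length + p.1, p.2))
  | _, _, .vcomp _ _ => []

end PT

/-- A single rewrite step on strings: replacing an occurrence of the left-hand
side of a rule by its right-hand side. -/
def StrStep (S : SRS α) (x y : List α) : Prop :=
  ∃ (u v : List α) (ρ : S.Rule), x = u ++ S.lhs ρ ++ v ∧ y = u ++ S.rhs ρ ++ v

end SRS

namespace SRS.PT

/-- A string viewed as a proof term is an empty multistep. -/
theorem isEmptyMS_ofString {α : Type u} (S : SRS α) (s : List α) :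
    IsEmptyMS (ofString S s) := by
  induction s with
  | nil => exact ⟨trivial, rfl⟩
  | cons a s ih => exact ⟨⟨trivial, ih.1⟩, (Nat.zero_add _).trans ih.2⟩

/-- A multistep is permutation equivalent to any multistep contained in it followed by the
corresponding residual. -/
theorem Resid.permEq_vcomp {α : Type u} {S : SRS α} {s t u : List α}
    {Φ : PT S s t} {Ψ : PT S s u} {Θ : PT S t u} (h : Resid Φ Ψ Θ) :
    PermEq (Φ.vcomp Θ) Ψ := by
  induction h with
  | eps => exact .vUnitL ⟨trivial, rfl⟩
  | letter a => exact .vUnitL ⟨trivial, rfl⟩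
  | ruleKept ρ => exact .vUnitR (isEmptyMS_ofString S _)
  | ruleSkipped ρ => exact .vUnitL (isEmptyMS_ofString S _)
  | hcomp _ _ ih₁ ih₂ => exact .trans (.exchange _ _ _ _) (.hcongr ih₁ ih₂)

end SRS.PT

open SRS.PT in
/-- Swapping preserves permutation equivalence: if the pair `Φ·Ψ` is loath
witnessed by `X` (with `ψ := X/Φ` a step and `ψ ⊆ Ψ` with residual `Θ = Ψ/ψ`),
then `Φ·Ψ` is permutation equivalent to the swap result `X·(Ψ/ψ)`. -/
theorem statement6 {α : Type u} {S : SRS α} {s t u v : List α}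
    {Φ : SRS.PT S s t} {Ψ : SRS.PT S t u} {X : SRS.PT S s v} {ψ : SRS.PT S t v}
    {Θ : SRS.PT S v u}
    (hX : X.noVcomp) (hres : Resid Φ X ψ) (hstep : IsStep ψ) (hres' : Resid ψ Ψ Θ) :
    PermEq (Φ.vcomp Ψ) (X.vcomp Θ) := by
  exact .trans (.vcongr (.refl Φ) hres'.permEq_vcomp.symm)
    (.trans (.symm (.vAssoc Φ ψ Θ)) (.vcongr hres.permEq_vcomp (.refl Θ)))
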